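/- Any two minimizers of the group lasso objective have the same penalty value: if β¹ and β² both minimize L over ℝᵖ, then Σ_{k=1}^K ‖β¹_k‖₂ = Σ_{k=1}^K ‖β²_k‖₂. -/

import Mathlib

/-- The fitted values `Xβ` for a column-wise grouped design matrix
`X = (X₁ … X_K)` with `X k : ℝ^{n × p k}` and blockwise coefficients `β`. -/
noncomputable def fitted {n K : ℕ} {p : Fin K → ℕ}
    (X : ∀ k, Matrix (Fin n) (Fin (p k)) ℝ) (β : ∀ k, Fin (p k) → ℝ)
    (i : Fin n) : ℝ :=
  ∑ k, ∑ j, X k i j * β k j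

/-- The sum of the groupwise Euclidean norms `Σ_k ‖β_k‖₂`. -/
noncomputable def groupNormSum {K : ℕ} {p : Fin K → ℕ}
    (β : ∀ k, Fin (p k) → ℝ) : ℝ :=
  ∑ k, Real.sqrt (∑ j, β k j ^ 2)

/-- The group lasso objective `L(β) = (1/2)‖y − Xβ‖₂² + λ Σ_k ‖β_k‖₂`. -/
noncomputable def groupLasso {n K : ℕ} {p : Fin K → ℕ}
    (X : ∀ k, Matrix (Fin n) (Fin (p k)) ℝ) (y : Fin n → ℝ) (lam : ℝ)
    (β : ∀ k, Fin (p k) → ℝ) : ℝ :=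
  (1 / 2) * ∑ i, (y i - fitted X β i) ^ 2 + lam * groupNormSum β


/-- The fitted values of a midpoint are the midpoint of the fitted values. -/
lemma fitted_midpoint {n K : ℕ} {p : Fin K → ℕ}
    (X : ∀ k, Matrix (Fin n) (Fin (p k)) ℝ) (β γ : ∀ k, Fin (p k) → ℝ) (i : Fin n) :
    fitted X (fun k j => (β k j + γ k j) / 2) i = (fitted X β i + fitted X γ i) / 2 := by
  simp only [fitted, ← Finset.sum_add_distrib, Finset.sum_div]
  refine Finset.sum_congr rfl fun k _ => Finset.sum_congr rfl fun j _ => ?_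
  ring

/-- The Euclidean norm of a midpoint is at most the mean of the Euclidean norms. -/
lemma sqrt_sum_sq_midpoint_le {ι : Type*} [Fintype ι] (u v : ι → ℝ) :
    √(∑ j, ((u j + v j) / 2) ^ 2) ≤ (√(∑ j, u j ^ 2) + √(∑ j, v j ^ 2)) / 2 := by
  have h := norm_add_le (WithLp.toLp 2 u : EuclideanSpace ℝ ι) (WithLp.toLp 2 v)
  simp only [EuclideanSpace.norm_eq, PiLp.add_apply, Real.norm_eq_abs, sq_abs] at h
  have hs : ∑ j, ((u j + v j) / 2) ^ 2 = (∑ j, (u j + v j) ^ 2) / 2 ^ 2 := by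
    simp only [div_pow, Finset.sum_div]
  rw [hs, Real.sqrt_div' _ (by positivity), Real.sqrt_sq (by norm_num)]
  linarith

/-- The group norm sum is midpoint convex. -/
lemma groupNormSum_midpoint_le {K : ℕ} {p : Fin K → ℕ} (β γ : ∀ k, Fin (p k) → ℝ) :
    groupNormSum (fun k j => (β k j + γ k j) / 2) ≤ (groupNormSum β + groupNormSum γ) / 2 := by
  simp only [groupNormSum, ← Finset.sum_add_distrib, Finset.sum_div]
  exact Finset.sum_le_sum fun k _ => sqrt_sum_sq_midpoint_le (β k) (γ k)

/-- The parallelogram identity for the residual sum of squares. -/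
lemma sum_sq_sub_midpoint {ι : Type*} [Fintype ι] (y f g : ι → ℝ) :
    ∑ i, (y i - (f i + g i) / 2) ^ 2 =
      (∑ i, (y i - f i) ^ 2 + ∑ i, (y i - g i) ^ 2) / 2 - (∑ i, (f i - g i) ^ 2) / 4 := by
  simp only [← Finset.sum_add_distrib, Finset.sum_div, ← Finset.sum_sub_distrib]
  exact Finset.sum_congr rfl fun i _ => by ring

/-- Two minimizers of the group lasso objective have the same fitted values. -/
lemma fitted_eq_of_minimizers {n K : ℕ} {p : Fin K → ℕ}
    (X : ∀ k, Matrix (Fin n) (Fin (p k)) ℝ) (y : Fin n → ℝ) (lam : ℝ) (hlam : 0 ≤ lam)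
    (β γ : ∀ k, Fin (p k) → ℝ)
    (hβ : ∀ δ, groupLasso X y lam β ≤ groupLasso X y lam δ)
    (hγ : ∀ δ, groupLasso X y lam γ ≤ groupLasso X y lam δ) :
    fitted X β = fitted X γ := by
  have hmβ := hβ fun k j => (β k j + γ k j) / 2
  have hmγ := hγ fun k j => (β k j + γ k j) / 2
  have hpen := mul_le_mul_of_nonneg_left (groupNormSum_midpoint_le β γ) hlam
  simp only [groupLasso, fitted_midpoint, sum_sq_sub_midpoint] at hmβ hmγ
  have hle : ∑ i, (fitted X β i - fitted X γ i) ^ 2 ≤ 0 := by linarith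
  have hzero := (Finset.sum_eq_zero_iff_of_nonneg fun i _ => sq_nonneg _).1
    (hle.antisymm (Finset.sum_nonneg fun i _ => sq_nonneg (fitted X β i - fitted X γ i)))
  funext i
  exact sub_eq_zero.1 (pow_eq_zero_iff two_ne_zero |>.1 (hzero i (Finset.mem_univ i)))

/-- Any two minimizers of the group lasso objective have the same penalty value. -/
theorem group_lasso_minimizers_same_penalty
    {n K : ℕ} {p : Fin K → ℕ}
    (X : ∀ k, Matrix (Fin n) (Fin (p k)) ℝ) (y : Fin n → ℝ)
    (lam : ℝ) (hlam : 0 < lam)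
    (β1 β2 : ∀ k, Fin (p k) → ℝ)
    (h1 : ∀ β, groupLasso X y lam β1 ≤ groupLasso X y lam β)
    (h2 : ∀ β, groupLasso X y lam β2 ≤ groupLasso X y lam β) :
    groupNormSum β1 = groupNormSum β2 := by
  have hfit := fitted_eq_of_minimizers X y lam hlam.le β1 β2 h1 h2
  have hval := (h1 β2).antisymm (h2 β1)
  simp only [groupLasso, hfit] at hval
  exact mul_left_cancel₀ hlam.ne' (add_left_cancel hval)
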